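/- arXiv:1909.03572 — 4 statements merged into one kernel-verified Lean document; each statement's English description precedes it below -/
import Mathlib

section
/- Let a > 0 and 2 < p < ∞. There exists a constant C = C(a,p) > 0 such that for every radial f ∈ C_c^∞(ℝ² \ {0}; ℂ) one has the Gagliardo–Nirenberg inequality with inverse-square potential ∫_{ℝ²} |f|^{p+2} dx ≤ C · ( ∫_{ℝ²} |f|² dx ) · ( ∫_{ℝ²} ( ‖∇f‖² + a |f|²/|x|² ) dx )^{p/2}. -/
open MeasureTheory Real Complex

noncomputable section

/-- The plane `ℝ²` with its Euclidean structure. -/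
abbrev E2 := EuclideanSpace ℝ (Fin 2)

/-- `j`-th partial derivative of a complex-valued function on `ℝ²`. -/
def pd (f : E2 → ℂ) (j : Fin 2) (x : E2) : ℂ :=
  fderiv ℝ f x (EuclideanSpace.single j 1)

/-- `j`-th partial derivative of a real-valued function on `ℝ²`. -/
def pdR (w : E2 → ℝ) (j : Fin 2) (x : E2) : ℝ :=
  fderiv ℝ w x (EuclideanSpace.single j 1)

/-- Laplacian of a complex-valued function on `ℝ²`. -/
def lap (f : E2 → ℂ) (x : E2) : ℂ := ∑ j, pd (fun y => pd f j y) j x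

/-- Laplacian of a real-valued function on `ℝ²`. -/
def lapR (w : E2 → ℝ) (x : E2) : ℝ := ∑ j, pdR (fun y => pdR w j y) j x

/-- A function on `ℝ²` is radial if it depends only on the norm. -/
def IsRadial (f : E2 → ℂ) : Prop := ∃ g : ℝ → ℂ, ∀ x, f x = g ‖x‖

/-- The Aharonov–Bohm potential `A(x) = α (−x₂/|x|², x₁/|x|²)`. -/
def ABpot (α : ℝ) (x : E2) : Fin 2 → ℝ := ![-α * x 1 / ‖x‖ ^ 2, α * x 0 / ‖x‖ ^ 2]

/-- dividing a continuous function vanishing near zero -/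
lemma cont_div_aux {X : Type*} [TopologicalSpace X] (u v : X → ℝ) (hu : Continuous u)
    (hv : Continuous v) (h : ∀ x, v x = 0 → ∀ᶠ y in nhds x, u y = 0) :
    Continuous fun x => u x / v x := by
  rw [continuous_iff_continuousAt]
  intro x
  by_cases hx : v x = 0
  · have : (fun y => u y / v y) =ᶠ[nhds x] fun _ => 0 := by
      filter_upwards [h x hx] with y hy
      simp [hy]
    exact continuousAt_const.congr this.symm
  · exact hu.continuousAt.div hv.continuousAt hx

lemma radial_sup_bound (h : ℝ → ℂ) (hc : ContDiff ℝ 1 h) (hs : HasCompactSupport h)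
    (h0 : ∀ᶠ s in nhds (0 : ℝ), h s = 0) (r : ℝ) (hr : 0 < r) :
    ‖h r‖ ^ 2 ≤ ∫ s in Set.Ioi (0 : ℝ), s * (‖deriv h s‖ ^ 2 + ‖h s‖ ^ 2 / s ^ 2) := by
  have hd : Continuous (deriv h) := hc.continuous_deriv le_rfl
  have hF : ContDiff ℝ 1 (fun s => ‖h s‖ ^ 2) := hc.norm_sq ℝ
  have hFs : HasCompactSupport (fun s => ‖h s‖ ^ 2) :=
    hs.comp_left (g := fun z : ℂ => ‖z‖ ^ 2) (by simp)
  have hderiv : ∀ s, deriv (fun s => ‖h s‖ ^ 2) s = 2 * inner ℝ (h s) (deriv h s) := fun s =>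
    ((hc.differentiable one_ne_zero s).hasDerivAt.norm_sq).deriv
  have hq : Continuous fun s : ℝ => ‖h s‖ ^ 2 / s ^ 2 := by
    apply cont_div_aux _ _ (hc.continuous.norm.pow 2) (continuous_id.pow 2)
    intro x hx
    have : x = 0 := by simpa using hx
    subst this
    filter_upwards [h0] with y hy
    simp [hy]
  have hcont : Continuous fun s : ℝ => s * (‖deriv h s‖ ^ 2 + ‖h s‖ ^ 2 / s ^ 2) :=
    continuous_id.mul ((hd.norm.pow 2).add hq)
  have hsup : HasCompactSupport fun s : ℝ => s * (‖deriv h s‖ ^ 2 + ‖h s‖ ^ 2 / s ^ 2) := by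
    refine HasCompactSupport.mul_left (HasCompactSupport.add ?_ ?_)
    · exact hs.deriv.comp_left (g := fun z : ℂ => ‖z‖ ^ 2) (by simp)
    · simp only [div_eq_mul_inv]
      exact hFs.mul_right
  have hint := hcont.integrable_of_hasCompactSupport hsup (μ := volume)
  have hint2 : Integrable (deriv (fun s => ‖h s‖ ^ 2)) :=
    (hF.continuous_deriv le_rfl).integrable_of_hasCompactSupport hFs.deriv
  have key := hFs.integral_Ioi_deriv_eq hF r
  have hneg : ‖h r‖ ^ 2 = ∫ s in Set.Ioi r, - deriv (fun s => ‖h s‖ ^ 2) s := by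
    rw [integral_neg, key]; simp
  rw [hneg]
  calc _ ≤ ∫ s in Set.Ioi r, s * (‖deriv h s‖ ^ 2 + ‖h s‖ ^ 2 / s ^ 2) := by
        refine setIntegral_mono_on hint2.neg.integrableOn hint.integrableOn measurableSet_Ioi ?_
        intro s hs
        have hs0 : 0 < s := hr.trans hs
        rw [hderiv]
        have h1 := (abs_le.1 (abs_real_inner_le_norm (h s) (deriv h s))).1
        have h2 : s * (‖deriv h s‖ ^ 2 + ‖h s‖ ^ 2 / s ^ 2) - 2 * (‖h s‖ * ‖deriv h s‖)
            = (s * ‖deriv h s‖ - ‖h s‖) ^ 2 / s := by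
          field_simp
          ring
        have h3 : 0 ≤ (s * ‖deriv h s‖ - ‖h s‖) ^ 2 / s := by positivity
        linarith
    _ ≤ _ := by
        refine setIntegral_mono_set hint.integrableOn ?_ ?_
        · filter_upwards [ae_restrict_mem measurableSet_Ioi] with s hs
          have : 0 < s := hs
          simp only [Pi.zero_apply]
          positivity
        · exact (Set.Ioi_subset_Ioi hr.le).eventuallyLE

lemma radial_grad (f : E2 → ℂ) (hf : ContDiff ℝ 1 f) (hr : IsRadial f) (x : E2) (hx : x ≠ 0) :
    ‖deriv (fun s : ℝ => f (s • EuclideanSpace.single (0 : Fin 2) (1 : ℝ))) ‖x‖‖ ^ 2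
      ≤ ∑ j, ‖pd f j x‖ ^ 2 := by
  obtain ⟨g, hg⟩ := hr
  have hn : 0 < ‖x‖ := norm_pos_iff.2 hx
  have heq : (fun s : ℝ => f (s • EuclideanSpace.single (0 : Fin 2) (1 : ℝ)))
      = fun s : ℝ => f (s • (‖x‖⁻¹ • x)) := by
    funext s
    rw [hg, hg]
    congr 1
    simp [norm_smul, hn.ne']
  rw [heq]
  have hx1 : ‖x‖ • (‖x‖⁻¹ • x) = x := by rw [smul_smul, mul_inv_cancel₀ hn.ne', one_smul]
  have hD : HasDerivAt (fun s : ℝ => f (s • (‖x‖⁻¹ • x))) (fderiv ℝ f x (‖x‖⁻¹ • x)) ‖x‖ := by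
    have h1 : HasFDerivAt f (fderiv ℝ f x) (‖x‖ • (‖x‖⁻¹ • x)) := by
      rw [hx1]; exact (hf.differentiable one_ne_zero x).hasFDerivAt
    have h2 : HasDerivAt (fun s : ℝ => s • (‖x‖⁻¹ • x)) ((1 : ℝ) • (‖x‖⁻¹ • x)) ‖x‖ :=
      (hasDerivAt_id _).smul_const _
    rw [one_smul] at h2
    exact h1.comp_hasDerivAt _ h2
  rw [hD.deriv]
  have hxs : x = x 0 • EuclideanSpace.single (0 : Fin 2) (1 : ℝ)
      + x 1 • EuclideanSpace.single (1 : Fin 2) (1 : ℝ) := by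
    ext i; fin_cases i <;> simp
  have hDx : fderiv ℝ f x x = (x 0 : ℝ) • pd f 0 x + (x 1 : ℝ) • pd f 1 x := by
    conv_lhs => rw [hxs]
    rw [map_add, map_smul, map_smul]
    rw [← hxs]
    rfl
  rw [map_smul, norm_smul, hDx, Fin.sum_univ_two, mul_pow, norm_inv, norm_norm, inv_pow]
  have hnx : ‖x‖ ^ 2 = x 0 ^ 2 + x 1 ^ 2 := by
    rw [EuclideanSpace.norm_sq_eq]; simp
  rw [inv_mul_le_iff₀ (by positivity), hnx]
  have h1 : ‖(x 0 : ℝ) • pd f 0 x + (x 1 : ℝ) • pd f 1 x‖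
      ≤ |x 0| * ‖pd f 0 x‖ + |x 1| * ‖pd f 1 x‖ := by
    refine (norm_add_le _ _).trans (le_of_eq ?_)
    rw [norm_smul, norm_smul, Real.norm_eq_abs, Real.norm_eq_abs]
  have h2 := pow_le_pow_left₀ (norm_nonneg _) h1 2
  refine h2.trans ?_
  rw [← sq_abs (x 0), ← sq_abs (x 1)]
  nlinarith [sq_nonneg (|x 0| * ‖pd f 1 x‖ - |x 1| * ‖pd f 0 x‖)]

lemma energy_integrable (a : ℝ) (f : E2 → ℂ) (hf : ContDiff ℝ 1 f)
    (hs : HasCompactSupport f) (hf0 : ∀ᶠ y in nhds (0 : E2), f y = 0) :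
    Integrable (fun x : E2 => ((∑ j, ‖pd f j x‖ ^ 2) + a * ‖f x‖ ^ 2 / ‖x‖ ^ 2)) := by
  have hpdc : ∀ j, Continuous (pd f j) := fun j =>
    (hf.continuous_fderiv one_ne_zero).clm_apply continuous_const
  have hpds : ∀ j, HasCompactSupport (pd f j) := fun j =>
    (hs.fderiv (𝕜 := ℝ)).comp_left (g := fun L : E2 →L[ℝ] ℂ => L (EuclideanSpace.single j 1)) rfl
  have h1 : Integrable (fun x => ∑ j, ‖pd f j x‖ ^ 2) := by
    refine integrable_finsetSum _ fun j _ => ?_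
    have hc : Continuous fun x => ‖pd f j x‖ ^ 2 := (hpdc j).norm.pow 2
    have hcs : HasCompactSupport fun x => ‖pd f j x‖ ^ 2 :=
      (hpds j).comp_left (g := fun z : ℂ => ‖z‖ ^ 2) (by simp)
    exact hc.integrable_of_hasCompactSupport hcs
  have h2 : Integrable (fun x : E2 => a * ‖f x‖ ^ 2 / ‖x‖ ^ 2) := by
    have hc : Continuous (fun x : E2 => a * ‖f x‖ ^ 2 / ‖x‖ ^ 2) := by
      refine cont_div_aux _ _ (continuous_const.mul (hf.continuous.norm.pow 2))
          (continuous_norm.pow 2) ?_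
      intro y hy
      have : y = 0 := by simpa using hy
      subst this
      filter_upwards [hf0] with z hz
      simp [hz]
    have hcs : HasCompactSupport (fun x : E2 => a * ‖f x‖ ^ 2 / ‖x‖ ^ 2) := by
      simp only [div_eq_mul_inv]
      have h3 : HasCompactSupport (fun x : E2 => a * ‖f x‖ ^ 2) :=
        hs.comp_left (g := fun z : ℂ => a * ‖z‖ ^ 2) (by simp)
      exact h3.mul_right
    exact hc.integrable_of_hasCompactSupport hcs
  exact h1.add h2

lemma sup_energy (a : ℝ) (ha : 0 < a) (f : E2 → ℂ) (hf : ContDiff ℝ 1 f)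
    (hs : HasCompactSupport f) (h0 : (0 : E2) ∉ tsupport f) (hr : IsRadial f) (x : E2) :
    ‖f x‖ ^ 2 ≤ (2 * volume.real (Metric.ball (0 : E2) 1) * min 1 a)⁻¹ *
      ∫ x, ((∑ j, ‖pd f j x‖ ^ 2) + a * ‖f x‖ ^ 2 / ‖x‖ ^ 2) := by
  have hV : 0 < volume.real (Metric.ball (0 : E2) 1) :=
    ENNReal.toReal_pos (Metric.measure_ball_pos _ _ one_pos).ne' measure_ball_lt_top.ne
  have hm : 0 < min 1 a := lt_min one_pos ha
  have hf0 : ∀ᶠ y in nhds (0 : E2), f y = 0 := notMem_tsupport_iff_eventuallyEq.1 h0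
  rcases eq_or_ne x 0 with rfl | hx
  · rw [hf0.self_of_nhds]
    have : 0 ≤ ∫ x, ((∑ j, ‖pd f j x‖ ^ 2) + a * ‖f x‖ ^ 2 / ‖x‖ ^ 2) :=
      integral_nonneg fun y => by positivity
    rw [norm_zero, zero_pow two_ne_zero]
    exact mul_nonneg (by positivity) this
  set e : E2 := EuclideanSpace.single (0 : Fin 2) (1 : ℝ) with he
  have hen : ‖e‖ = 1 := by simp [he]
  set h : ℝ → ℂ := fun s => f (s • e) with hh
  have hhc : ContDiff ℝ 1 h := hf.comp (contDiff_id.smul contDiff_const)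
  have hhs : HasCompactSupport h := by
    refine hs.comp_isClosedEmbedding (g := fun s : ℝ => s • e) ?_
    have : Isometry (fun s : ℝ => s • e) := by
      refine Isometry.of_dist_eq fun s t => ?_
      rw [dist_eq_norm, ← sub_smul, norm_smul, hen, mul_one, dist_eq_norm]
    exact this.isClosedEmbedding
  have hh0 : ∀ᶠ s in nhds (0 : ℝ), h s = 0 := by
    have : Filter.Tendsto (fun s : ℝ => s • e) (nhds 0) (nhds 0) := by
      have h1 : Continuous (fun s : ℝ => s • e) := by fun_prop
      simpa using h1.tendsto 0
    exact this.eventually hf0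
  have hfh : ∀ y : E2, f y = h ‖y‖ := by
    intro y
    obtain ⟨g, hg⟩ := hr
    simp only [hh]
    rw [hg, hg, norm_smul, hen, norm_norm, mul_one]
  have hb := radial_sup_bound h hhc hhs hh0 ‖x‖ (norm_pos_iff.2 hx)
  rw [← hfh] at hb
  refine hb.trans ?_
  have hpolar := integral_fun_norm_addHaar (volume : Measure E2)
    (fun s : ℝ => ‖deriv h s‖ ^ 2 + ‖h s‖ ^ 2 / s ^ 2)
  simp only [finrank_euclideanSpace, Fintype.card_fin, smul_eq_mul, nsmul_eq_mul,
    Nat.add_one_sub_one, pow_one, Nat.cast_ofNat] at hpolar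
  have hint := energy_integrable a f hf hs hf0
  have hcomp : min 1 a * ∫ x : E2, (‖deriv h ‖x‖‖ ^ 2 + ‖h ‖x‖‖ ^ 2 / ‖x‖ ^ 2)
      ≤ ∫ x, ((∑ j, ‖pd f j x‖ ^ 2) + a * ‖f x‖ ^ 2 / ‖x‖ ^ 2) := by
    rw [← integral_const_mul]
    refine integral_mono_of_nonneg (Filter.Eventually.of_forall fun y => ?_) hint ?_
    · simp only [Pi.zero_apply]
      positivity
    · filter_upwards [Measure.ae_ne volume (0 : E2)] with y hy
      have h1 := radial_grad f hf hr y hy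
      rw [← he, ← hh] at h1
      rw [← hfh, mul_add, mul_div_assoc]
      refine add_le_add ?_ ?_
      · refine le_trans ?_ h1
        exact mul_le_of_le_one_left (by positivity) (min_le_left _ _)
      · exact mul_le_mul_of_nonneg_right (min_le_right _ _) (by positivity)
  rw [hpolar] at hcomp
  rw [le_inv_mul_iff₀ (by positivity)]
  refine le_trans (le_of_eq ?_) hcomp
  ring

lemma gn_final (p : ℝ) (hp : 2 < p) (K E : ℝ) (hK0 : 0 < K) (hE : 0 ≤ E) (f : E2 → ℂ)
    (hfc : Continuous f) (hs : HasCompactSupport f) (hsup : ∀ x, ‖f x‖ ^ 2 ≤ K * E) :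
    ∫ x, ‖f x‖ ^ (p + 2) ≤ K ^ (p / 2) * (∫ x, ‖f x‖ ^ 2) * E ^ (p / 2) := by
  have hc2 : Continuous fun x => ‖f x‖ ^ 2 := hfc.norm.pow 2
  have hs2 : HasCompactSupport fun x => ‖f x‖ ^ 2 :=
    hs.comp_left (g := fun z : ℂ => ‖z‖ ^ 2) (by simp)
  have hint : Integrable fun x => ‖f x‖ ^ 2 :=
    hc2.integrable_of_hasCompactSupport hs2
  have hmain : ∫ x, ‖f x‖ ^ (p + 2) ≤ ∫ x, (K * E) ^ (p / 2) * ‖f x‖ ^ 2 := by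
    refine integral_mono_of_nonneg (Filter.Eventually.of_forall fun y => ?_)
      (hint.const_mul _) (Filter.Eventually.of_forall fun y => ?_)
    · simp only [Pi.zero_apply]
      positivity
    · have h1 : ‖f y‖ ^ (p + 2) = (‖f y‖ ^ 2) ^ (p / 2) * ‖f y‖ ^ 2 := by
        rw [Real.rpow_add_of_nonneg (norm_nonneg _) (by linarith) (by norm_num),
          ← Real.rpow_natCast, ← Real.rpow_mul (norm_nonneg _)]
        congr 2
        push_cast
        ring
      simp only [h1]
      exact mul_le_mul_of_nonneg_right
        (Real.rpow_le_rpow (by positivity) (hsup y) (by linarith)) (by positivity)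
  rw [integral_const_mul, Real.mul_rpow hK0.le hE] at hmain
  refine hmain.trans (le_of_eq ?_)
  ring


/-- Gagliardo–Nirenberg inequality with inverse-square potential: for `a > 0` and
`2 < p < ∞` there is `C = C(a,p) > 0` with
`∫ |f|^{p+2} ≤ C (∫ |f|²) (∫ (‖∇f‖² + a|f|²/|x|²))^{p/2}` for all radial
`f ∈ C_c^∞(ℝ² \ {0})`. -/
theorem gagliardo_nirenberg_inverse_square (a p : ℝ) (ha : 0 < a) (hp : 2 < p) :
    ∃ C : ℝ, 0 < C ∧ ∀ f : E2 → ℂ, ContDiff ℝ (⊤ : ℕ∞) f → HasCompactSupport f →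
      (0 : E2) ∉ tsupport f → IsRadial f →
      ∫ x, ‖f x‖ ^ (p + 2)
        ≤ C * (∫ x, ‖f x‖ ^ 2) *
          (∫ x, ((∑ j, ‖pd f j x‖ ^ 2) + a * ‖f x‖ ^ 2 / ‖x‖ ^ 2)) ^ (p / 2) := by
  have hV : 0 < volume.real (Metric.ball (0 : E2) 1) :=
    ENNReal.toReal_pos (Metric.measure_ball_pos _ _ one_pos).ne' measure_ball_lt_top.ne
  have hm : 0 < min 1 a := lt_min one_pos ha
  obtain ⟨K, hK⟩ : ∃ K, K = (2 * volume.real (Metric.ball (0 : E2) 1) * min 1 a)⁻¹ := ⟨_, rfl⟩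
  have hK0 : 0 < K := by rw [hK]; positivity
  refine ⟨K ^ (p / 2), by positivity, ?_⟩
  intro f hf hs h0 hr
  have hf1 : ContDiff ℝ 1 f := hf.of_le (by exact_mod_cast le_top)
  have hsup := sup_energy a ha f hf1 hs h0 hr
  rw [← hK] at hsup
  have hE : 0 ≤ ∫ x, ((∑ j, ‖pd f j x‖ ^ 2) + a * ‖f x‖ ^ 2 / ‖x‖ ^ 2) :=
    integral_nonneg fun y => by positivity
  generalize (∫ x, ((∑ j, ‖pd f j x‖ ^ 2) + a * ‖f x‖ ^ 2 / ‖x‖ ^ 2)) = E at hE hsup ⊢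
  exact gn_final p hp K E hK0 hE f hf1.continuous hs hsup
end
end

section
/- Let a > 0 and 2 < p < ∞. Assume u : ℝ × ℝ² → ℂ is smooth on ℝ × (ℝ² \ {0}), there is a compact set K ⊆ ℝ² \ {0} with supp u(t,·) ⊆ K for all t, and u solves the focusing equation i∂_t u + Δu − (a/|x|²)u = −|u|^p u on ℝ × (ℝ² \ {0}). Then the energy E(u(t)) := ∫_{ℝ²} [ ½‖∇u(t,x)‖² + (a/2)|u(t,x)|²/|x|² − (1/(p+2))|u(t,x)|^{p+2} ] dx is constant in time. -/
open MeasureTheory Real Complex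

noncomputable section

theorem aux_contDiff {W : ℝ × E2 → ℂ} (hW : ContDiff ℝ (⊤ : ℕ∞) W) (c : ℝ × E2) :
    ContDiff ℝ (⊤ : ℕ∞) (fun q => fderiv ℝ W q c) :=
  (hW.fderiv_right (m := (⊤ : ℕ∞)) (by exact_mod_cast le_rfl)).clm_apply contDiff_const

theorem aux_differentiable {W : ℝ × E2 → ℂ} (hW : ContDiff ℝ (⊤ : ℕ∞) W) :
    Differentiable ℝ W := hW.differentiable (by simp)

theorem aux_fderiv {W : ℝ × E2 → ℂ} (hW : ContDiff ℝ (⊤ : ℕ∞) W) (t : ℝ) (x d : E2) :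
    fderiv ℝ (fun y => W (t, y)) x d = fderiv ℝ W (t, x) (0, d) := by
  have h1 : HasFDerivAt (fun y : E2 => (t, y)) (ContinuousLinearMap.inr ℝ ℝ E2) x :=
    hasFDerivAt_prodMk_right t x
  have h2 := ((aux_differentiable hW) (t, x)).hasFDerivAt.comp x h1
  have h3 : fderiv ℝ (fun y => W (t, y)) x = _ := h2.fderiv
  rw [h3]
  simp

theorem aux_pd {W : ℝ × E2 → ℂ} (hW : ContDiff ℝ (⊤ : ℕ∞) W) (t : ℝ) (j : Fin 2) (x : E2) :
    pd (fun y => W (t, y)) j x = fderiv ℝ W (t, x) (0, EuclideanSpace.single j 1) :=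
  aux_fderiv hW t x _

theorem aux_dt {W : ℝ × E2 → ℂ} (hW : ContDiff ℝ (⊤ : ℕ∞) W) (t : ℝ) (x : E2) :
    HasDerivAt (fun s => W (s, x)) (fderiv ℝ W (t, x) (1, 0)) t := by
  have h1 : HasDerivAt (fun s : ℝ => (s, x)) ((1 : ℝ), (0 : E2)) t :=
    (hasDerivAt_id t).prodMk (hasDerivAt_const t x)
  exact ((aux_differentiable hW) (t, x)).hasFDerivAt.comp_hasDerivAt t h1

theorem aux_symm {W : ℝ × E2 → ℂ} (hW : ContDiff ℝ (⊤ : ℕ∞) W) (q c d : ℝ × E2) :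
    fderiv ℝ (fun r => fderiv ℝ W r c) q d = fderiv ℝ (fun r => fderiv ℝ W r d) q c := by
  have hd : Differentiable ℝ (fderiv ℝ W) :=
    (hW.fderiv_right (m := (⊤ : ℕ∞)) (by exact_mod_cast le_rfl)).differentiable (by simp)
  have h := (hW.contDiffAt (x := q)).isSymmSndFDerivAt
    (by rw [minSmoothness_of_isRCLikeNormedField]; exact WithTop.coe_le_coe.2 le_top)
  rw [fderiv_clm_apply (hd q) (differentiableAt_const c),
    fderiv_clm_apply (hd q) (differentiableAt_const d)]
  simpa using h d c

theorem aux_supp {W : ℝ × E2 → ℂ} {K : Set E2} (hK : IsClosed K)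
    (h : ∀ t x, x ∉ K → W (t, x) = 0) (c : ℝ × E2) (t : ℝ) (x : E2) (hx : x ∉ K) :
    fderiv ℝ W (t, x) c = 0 := by
  have ho : IsOpen {q : ℝ × E2 | q.2 ∉ K} := hK.isOpen_compl.preimage continuous_snd
  have he : W =ᶠ[nhds (t, x)] fun _ => 0 := by
    filter_upwards [ho.mem_nhds (show (t, x) ∈ {q : ℝ × E2 | q.2 ∉ K} from hx)] with q hq
    exact h q.1 q.2 hq
  rw [he.fderiv_eq]
  simp

theorem aux_integrable {f : E2 → ℝ} {K : Set E2} (hK : IsCompact K)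
    (hf : ContinuousOn f K) (h : ∀ x, x ∉ K → f x = 0) : Integrable f := by
  rw [← integrableOn_iff_integrable_of_support_subset (s := K)]
  · exact hf.integrableOn_compact hK
  · intro x hx
    by_contra hc
    exact hx (h x hc)

theorem aux_ibp {V P : ℝ × E2 → ℂ} (hV : ContDiff ℝ (⊤ : ℕ∞) V) (hP : ContDiff ℝ (⊤ : ℕ∞) P)
    {K : Set E2} (hK : IsCompact K) (hVs : ∀ t x, x ∉ K → V (t, x) = 0) (d : E2) (t : ℝ) :
    Integrable (fun x => inner ℝ (V (t, x)) (fderiv ℝ P (t, x) (0, d))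
        + inner ℝ (fderiv ℝ V (t, x) (0, d)) (P (t, x))) ∧
    ∫ x, (inner ℝ (V (t, x)) (fderiv ℝ P (t, x) (0, d))
        + inner ℝ (fderiv ℝ V (t, x) (0, d)) (P (t, x))) = 0 := by
  have cm : Continuous (fun x : E2 => (t, x)) := by fun_prop
  have cV : Continuous (fun x => V (t, x)) := hV.continuous.comp cm
  have cP : Continuous (fun x => P (t, x)) := hP.continuous.comp cm
  have cV' : Continuous (fun x => fderiv ℝ V (t, x) (0, d)) :=
    (aux_contDiff hV (0, d)).continuous.comp cm
  have cP' : Continuous (fun x => fderiv ℝ P (t, x) (0, d)) :=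
    (aux_contDiff hP (0, d)).continuous.comp cm
  have i1 : Integrable (fun x => inner ℝ (V (t, x)) (fderiv ℝ P (t, x) (0, d))) :=
    aux_integrable hK (cV.inner cP').continuousOn (fun x hx => by simp [hVs t x hx])
  have i2 : Integrable (fun x => inner ℝ (fderiv ℝ V (t, x) (0, d)) (P (t, x))) :=
    aux_integrable hK (cV'.inner cP).continuousOn
      (fun x hx => by simp [aux_supp hK.isClosed hVs (0, d) t x hx])
  have i3 : Integrable (fun x => inner ℝ (V (t, x)) (P (t, x))) :=
    aux_integrable hK (cV.inner cP).continuousOn (fun x hx => by simp [hVs t x hx])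
  refine ⟨i1.add i2, ?_⟩
  rw [integral_add i1 i2]
  have dV : Differentiable ℝ (fun x => V (t, x)) :=
    (aux_differentiable hV).comp (by fun_prop : Differentiable ℝ (fun x : E2 => (t, x)))
  have dP : Differentiable ℝ (fun x => P (t, x)) :=
    (aux_differentiable hP).comp (by fun_prop : Differentiable ℝ (fun x : E2 => (t, x)))
  have := integral_bilinear_fderiv_right_eq_neg_left_of_integrable (μ := (volume : Measure E2))
    (f := fun x => V (t, x)) (g := fun x => P (t, x)) (v := d) (B := innerSL ℝ)
    (by simp only [aux_fderiv hV]; exact i2)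
    (by simp only [aux_fderiv hP]; exact i1)
    i3
    (fun x _ => dV x) (fun x _ => dP x)
  simp only [aux_fderiv hV, aux_fderiv hP] at this
  exact eq_neg_iff_add_eq_zero.1 this

/-- energy conservation for the focusing NLS with inverse-square potential: under
the same hypotheses as mass conservation, the energy
`E(u(t)) = ∫ (½‖∇u‖² + (a/2)|u|²/|x|² − (1/(p+2))|u|^{p+2}) dx` is constant in time. -/
theorem energy_conservation
    (a p : ℝ) (ha : 0 < a) (hp : 2 < p)
    (u : ℝ → E2 → ℂ)
    (hsmooth : ContDiffOn ℝ (⊤ : ℕ∞) (fun q : ℝ × E2 => u q.1 q.2)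
      (Set.univ ×ˢ {x : E2 | x ≠ 0}))
    (K : Set E2) (hKcomp : IsCompact K) (hK : K ⊆ {x : E2 | x ≠ 0})
    (hsupp : ∀ t : ℝ, Function.support (u t) ⊆ K)
    (heq : ∀ (t : ℝ) (x : E2), x ≠ 0 →
      Complex.I * deriv (fun s => u s x) t + lap (u t) x
          - ((a / ‖x‖ ^ 2 : ℝ) : ℂ) * u t x
        = -((‖u t x‖ ^ p : ℝ) : ℂ) * u t x) :
    ∀ t₁ t₂ : ℝ,
      (∫ x, ((1 : ℝ) / 2 * ∑ j, ‖pd (u t₁) j x‖ ^ 2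
          + a / 2 * ‖u t₁ x‖ ^ 2 / ‖x‖ ^ 2 - 1 / (p + 2) * ‖u t₁ x‖ ^ (p + 2)))
        = ∫ x, ((1 : ℝ) / 2 * ∑ j, ‖pd (u t₂) j x‖ ^ 2
          + a / 2 * ‖u t₂ x‖ ^ 2 / ‖x‖ ^ 2 - 1 / (p + 2) * ‖u t₂ x‖ ^ (p + 2)) := by
  classical
  have hKc : IsClosed K := hKcomp.isClosed
  obtain ⟨U, hUdef⟩ : ∃ U : ℝ × E2 → ℂ, U = fun q : ℝ × E2 => u q.1 q.2 := ⟨_, rfl⟩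
  have hUs : ∀ t x, x ∉ K → U (t, x) = 0 := by
    intro t x hx
    by_contra h
    exact hx (hsupp t (by simpa [hUdef] using h))
  have hu : ∀ t, u t = fun x => U (t, x) := fun t => by rw [hUdef]
  have hU : ContDiff ℝ (⊤ : ℕ∞) U := by
    rw [contDiff_iff_contDiffAt]
    rintro ⟨t, x⟩
    by_cases hx : x ∈ K
    · rw [hUdef]
      apply hsmooth.contDiffAt
      apply (isOpen_univ.prod isOpen_ne).mem_nhds
      exact ⟨trivial, hK hx⟩
    · have ho : IsOpen {q : ℝ × E2 | q.2 ∉ K} := hKc.isOpen_compl.preimage continuous_snd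
      have he : U =ᶠ[nhds (t, x)] fun _ => 0 := by
        filter_upwards [ho.mem_nhds (show (t, x) ∈ {q : ℝ × E2 | q.2 ∉ K} from hx)] with q hq
        exact hUs q.1 q.2 hq
      exact contDiffAt_const.congr_of_eventuallyEq he
  obtain ⟨V, hVdef⟩ : ∃ V : ℝ × E2 → ℂ, V = fun q => fderiv ℝ U q (1, 0) := ⟨_, rfl⟩
  have hV : ContDiff ℝ (⊤ : ℕ∞) V := by rw [hVdef]; exact aux_contDiff hU _
  have hVs : ∀ t x, x ∉ K → V (t, x) = 0 := by
    intro t x hx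
    rw [hVdef]
    exact aux_supp hKc hUs _ t x hx
  obtain ⟨e, he⟩ : ∃ e : Fin 2 → ℝ × E2, e = fun j => (0, EuclideanSpace.single j 1) := ⟨_, rfl⟩
  obtain ⟨P, hPdef⟩ : ∃ P : Fin 2 → ℝ × E2 → ℂ, P = fun j q => fderiv ℝ U q (e j) := ⟨_, rfl⟩
  have hP : ∀ j, ContDiff ℝ (⊤ : ℕ∞) (P j) := by
    intro j; rw [hPdef]; exact aux_contDiff hU _
  have hPs : ∀ j t x, x ∉ K → P j (t, x) = 0 := by
    intro j t x hx
    rw [hPdef]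
    exact aux_supp hKc hUs _ t x hx
  have hpd : ∀ t j x, pd (u t) j x = P j (t, x) := by
    intro t j x
    rw [hu, aux_pd hU, hPdef, he]
  have hlap : ∀ t x, lap (u t) x = ∑ j, fderiv ℝ (P j) (t, x) (e j) := by
    intro t x
    unfold lap
    refine Finset.sum_congr rfl fun j _ => ?_
    simp only [hpd]
    rw [aux_pd (hP j), he]
  have hPt : ∀ j q, fderiv ℝ (P j) q (1, 0) = fderiv ℝ V q (e j) := by
    intro j q
    rw [hPdef, hVdef]
    exact aux_symm hU _ _ _
  have hdt : ∀ t x, HasDerivAt (fun s => u s x) (V (t, x)) t := by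
    intro t x
    have := aux_dt hU t x
    rw [hVdef]
    simpa only [hUdef] using this
  -- the energy density and its time derivative
  obtain ⟨F, hF⟩ : ∃ F : ℝ → E2 → ℝ, F = fun t x => ((1 : ℝ) / 2 * ∑ j, ‖P j (t, x)‖ ^ 2
          + a / 2 * ‖U (t, x)‖ ^ 2 / ‖x‖ ^ 2 - 1 / (p + 2) * ‖U (t, x)‖ ^ (p + 2)) := ⟨_, rfl⟩
  obtain ⟨D, hD⟩ : ∃ D : ℝ → E2 → ℝ, D = fun t x =>
    ∑ j, (inner ℝ (V (t, x)) (fderiv ℝ (P j) (t, x) (e j))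
        + inner ℝ (fderiv ℝ V (t, x) (e j)) (P j (t, x))) := ⟨_, rfl⟩
  have hDcont : Continuous (fun q : ℝ × E2 => D q.1 q.2) := by
    rw [hD]
    refine continuous_finsetSum _ fun j _ => ?_
    exact (hV.continuous.inner (aux_contDiff (hP j) (e j)).continuous).add
      ((aux_contDiff hV (e j)).continuous.inner (hP j).continuous)
  have hDs : ∀ t x, x ∉ K → D t x = 0 := by
    intro t x hx
    rw [hD]
    simp [hVs t x hx, hPs _ t x hx]
  have hFs : ∀ t x, x ∉ K → F t x = 0 := by
    intro t x hx
    rw [hF]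
    have : p + 2 ≠ 0 := by linarith
    simp [hUs t x hx, hPs _ t x hx, Real.zero_rpow this]
  have hFint : ∀ t, Integrable (F t) := by
    intro t
    refine aux_integrable hKcomp ?_ (hFs t)
    have cm : Continuous (fun x : E2 => (t, x)) := by fun_prop
    have cU : Continuous (fun x => U (t, x)) := hU.continuous.comp cm
    have cP : ∀ j, Continuous (fun x => P j (t, x)) := fun j => (hP j).continuous.comp cm
    rw [hF]
    refine ContinuousOn.sub (ContinuousOn.add ?_ ?_) ?_
    · refine Continuous.continuousOn (continuous_const.mul ?_)
      exact continuous_finsetSum _ fun j _ => (cP j).norm.pow 2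
    · refine ContinuousOn.div (continuous_const.mul (cU.norm.pow 2)).continuousOn (by fun_prop) fun x hx => ?_
      have : x ≠ 0 := hK hx
      positivity
    · refine Continuous.continuousOn (continuous_const.mul ?_)
      exact cU.norm.rpow_const fun x => Or.inr (by linarith)
  have hFD : ∀ t x, HasDerivAt (fun s => F s x) (D t x) t := by
    intro t x
    have hUt : HasDerivAt (fun s => U (s, x)) (V (t, x)) t := by
      rw [hVdef]; exact aux_dt hU t x
    have h1 : HasDerivAt (fun s => ∑ j, ‖P j (s, x)‖ ^ 2)
        (∑ j, 2 * inner ℝ (P j (t, x)) (fderiv ℝ V (t, x) (e j))) t := by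
      refine HasDerivAt.fun_sum fun j _ => ?_
      have := (aux_dt (hP j) t x).norm_sq
      rw [hPt] at this
      exact this
    have h2 : HasDerivAt (fun s => ‖U (s, x)‖ ^ 2) (2 * inner ℝ (U (t, x)) (V (t, x))) t :=
      hUt.norm_sq
    have h3 : HasDerivAt (fun s => ‖U (s, x)‖ ^ (p + 2))
        ((p + 2) * ‖U (t, x)‖ ^ p * inner ℝ (U (t, x)) (V (t, x))) t := by
      have := (hasFDerivAt_norm_rpow (U (t, x)) (p := p + 2) (by linarith)).comp_hasDerivAt t hUt
      refine HasDerivAt.congr_deriv this ?_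
      rw [show p + 2 - 2 = p by ring]
      rfl
    have h := ((h1.const_mul ((1 : ℝ) / 2)).add ((h2.const_mul (a / 2)).div_const (‖x‖ ^ 2))).sub
      (h3.const_mul (1 / (p + 2)))
    rw [hF]
    refine h.congr_deriv ?_
    have hp2 : p + 2 ≠ 0 := by linarith
    have key : a * inner ℝ (U (t, x)) (V (t, x)) / ‖x‖ ^ 2
        - ‖U (t, x)‖ ^ p * inner ℝ (U (t, x)) (V (t, x))
        = ∑ j, inner ℝ (V (t, x)) (fderiv ℝ (P j) (t, x) (e j)) := by
      by_cases hx : x = 0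
      · have hx' : x ∉ K := fun h => hK h hx
        simp [hVs t x hx']
      · have h0 := heq t x hx
        rw [(hdt t x).deriv, hlap, hu] at h0
        rw [← inner_sum]
        have h4 : ∑ j, fderiv ℝ (P j) (t, x) (e j)
            = ((a / ‖x‖ ^ 2 : ℝ) : ℂ) * U (t, x) - ((‖U (t, x)‖ ^ p : ℝ) : ℂ) * U (t, x)
              - Complex.I * V (t, x) := by
          linear_combination h0
        rw [h4]
        simp only [Complex.inner, Complex.mul_re, Complex.mul_im, Complex.sub_re, Complex.sub_im,
          Complex.conj_re, Complex.conj_im, Complex.ofReal_re, Complex.ofReal_im, Complex.I_re,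
          Complex.I_im]
        ring
    rw [hD]
    simp only []
    rw [Finset.sum_add_distrib, ← key]
    have h5 : ∑ j, 2 * inner ℝ (P j (t, x)) (fderiv ℝ V (t, x) (e j))
        = 2 * ∑ j, inner ℝ (fderiv ℝ V (t, x) (e j)) (P j (t, x)) := by
      rw [Finset.mul_sum]
      exact Finset.sum_congr rfl fun j _ => by rw [real_inner_comm]
    rw [h5]
    field_simp
    ring
  have hD0 : ∀ t, ∫ x, D t x = 0 := by
    intro t
    rw [hD, he]
    simp only []
    rw [integral_finsetSum]
    · exact Finset.sum_eq_zero fun j _ => (aux_ibp hV (hP j) hKcomp hVs _ t).2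
    · exact fun j _ => (aux_ibp hV (hP j) hKcomp hVs _ t).1
  have hE : ∀ t, HasDerivAt (fun s => ∫ x, F s x) 0 t := by
    intro t
    rw [← hD0 t]
    obtain ⟨C, hC⟩ := ((isCompact_Icc (a := t - 1) (b := t + 1)).prod
      hKcomp).exists_bound_of_continuousOn hDcont.continuousOn
    refine (hasDerivAt_integral_of_dominated_loc_of_deriv_le (F := F) (F' := D)
      (s := Set.Icc (t - 1) (t + 1)) (bound := K.indicator fun _ => C)
      (Icc_mem_nhds (by linarith) (by linarith))
      (Filter.Eventually.of_forall fun s => (hFint s).aestronglyMeasurable) (hFint t)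
      ?_ ?_ ?_ ?_).2
    · exact (hDcont.comp (by fun_prop : Continuous fun x : E2 => (t, x))).aestronglyMeasurable
    · refine Filter.Eventually.of_forall fun x s hs => ?_
      by_cases hx : x ∈ K
      · rw [Set.indicator_of_mem hx]
        exact hC (s, x) ⟨hs, hx⟩
      · rw [Set.indicator_of_notMem hx, hDs s x hx]
        simp
    · rw [integrable_indicator_iff hKc.measurableSet]
      exact continuousOn_const.integrableOn_compact hKcomp
    · exact Filter.Eventually.of_forall fun x s _ => hFD s x
  intro t₁ t₂
  have hfin := is_const_of_deriv_eq_zero (fun t => (hE t).differentiableAt)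
    (fun t => (hE t).deriv) t₁ t₂
  simp only [hpd]
  simp only [hu]
  simpa only [hF] using hfin
end
end

section
/- For every u ∈ C_c^∞(ℝ² \ {0}; ℂ) one has the identity Re ∫_{ℝ²} ( \overline{u(x)}/|x|² ) · ( (x/|x|)·∇u(x) ) dx = ½ ∫_{ℝ²} |u(x)|²/|x|³ dx. -/
open MeasureTheory Real Complex

noncomputable section

lemma aux_ev {V : Type*} [NormedAddCommGroup V] (u : E2 → ℂ)
    (hsupp : (0 : E2) ∉ tsupport u) (h : E2 → V) (h0 : ∀ x, u x = 0 → h x = 0) :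
    h =ᶠ[nhds 0] fun _ => 0 := by
  have := notMem_tsupport_iff_eventuallyEq.1 hsupp
  filter_upwards [this] with x hx
  exact h0 x hx

lemma aux_int {V : Type*} [NormedAddCommGroup V] (u : E2 → ℂ) (hcomp : HasCompactSupport u)
    (hsupp : (0 : E2) ∉ tsupport u) (h : E2 → V) (hc : ∀ x ≠ 0, ContinuousAt h x)
    (h0 : ∀ x, u x = 0 → h x = 0) : Integrable h := by
  have hcont : Continuous h := by
    rw [continuous_iff_continuousAt]
    intro x
    by_cases hx : x = 0
    · subst hx
      exact continuousAt_const.congr (aux_ev u hsupp h h0).symm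
    · exact hc x hx
  refine hcont.integrable_of_hasCompactSupport (hcomp.mono ?_)
  intro x hx hux
  exact hx (h0 x hux)

lemma aux_div (F : E2 → ℝ) (hF : ContDiff ℝ 1 F) (hc : HasCompactSupport F) (v : E2) :
    Integrable (fun x => fderiv ℝ F x v) ∧ ∫ x, fderiv ℝ F x v = 0 := by
  have hi : Integrable (fun x => fderiv ℝ F x v) :=
    ((hF.continuous_fderiv (by norm_num)).clm_apply
      continuous_const).integrable_of_hasCompactSupport (hc.fderiv_apply ℝ v)
  refine ⟨hi, ?_⟩
  have := integral_mul_fderiv_eq_neg_fderiv_mul_of_integrable (μ := (volume : Measure E2))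
    (f := fun _ : E2 => (1 : ℝ)) (g := F) (v := v) (by simp)
    (by simpa using hi) (by simpa using hF.continuous.integrable_of_hasCompactSupport hc)
    (fun x _ => by fun_prop) (fun x _ => (hF.differentiable (by norm_num)) x)
  simpa using this

lemma aux_norm (x v : E2) (hx : x ≠ 0) :
    fderiv ℝ (fun y : E2 => ‖y‖) x v = inner ℝ x v / ‖x‖ := by
  have hd : HasFDerivAt (fun y : E2 => ‖y‖) (fderiv ℝ (fun y : E2 => ‖y‖) x) x :=
    ((contDiffAt_norm ℝ (n := 1) hx).differentiableAt (by norm_num)).hasFDerivAt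
  have h1 := hd.pow 2
  have h2 := (hasFDerivAt_id x).norm_sq
  have h3 := congrArg (fun L => L v) (h1.unique h2)
  have : ‖x‖ ≠ 0 := norm_ne_zero_iff.2 hx
  simp at h3
  field_simp
  linarith

lemma aux_usq (u : E2 → ℂ) (hu : Differentiable ℝ u) (x v : E2) :
    HasFDerivAt (fun y => ‖u y‖ ^ 2) (2 • (innerSL ℝ (u x)).comp (fderiv ℝ u x)) x :=
  (hu x).hasFDerivAt.norm_sq

lemma aux_pt (u : E2 → ℂ) (hu : Differentiable ℝ u) (x : E2) (hx : x ≠ 0) (j : Fin 2) :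
    fderiv ℝ (fun y : E2 => ‖u y‖ ^ 2 * (y j * (‖y‖ ^ 3)⁻¹)) x (EuclideanSpace.single j 1)
      = 2 * ((starRingEnd ℂ) (u x) * pd u j x).re * (x j / ‖x‖ ^ 3)
        + ‖u x‖ ^ 2 * (1 / ‖x‖ ^ 3 - 3 * x j ^ 2 / ‖x‖ ^ 5) := by
  have hn : ‖x‖ ≠ 0 := norm_ne_zero_iff.2 hx
  have hd : HasFDerivAt (fun y : E2 => ‖y‖) (fderiv ℝ (fun y : E2 => ‖y‖) x) x :=
    ((contDiffAt_norm ℝ (n := 1) hx).differentiableAt (by norm_num)).hasFDerivAt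
  have hj : HasFDerivAt (fun y : E2 => y j) (EuclideanSpace.proj (𝕜 := ℝ) j : E2 →L[ℝ] ℝ) x :=
    (EuclideanSpace.proj (𝕜 := ℝ) j : E2 →L[ℝ] ℝ).hasFDerivAt
  have hi := (hasDerivAt_inv (pow_ne_zero 3 hn)).comp_hasFDerivAt x (hd.pow 3)
  have := (aux_usq u hu x x).mul (hj.mul hi)
  have h2 := this.fderiv
  simp only [Function.comp_def] at h2
  erw [h2]
  simp [aux_norm x _ hx, pd, Complex.inner, EuclideanSpace.inner_single_right]
  field_simp
  ring

/-- for `u ∈ C_c^∞(ℝ² \ {0})`,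
`Re ∫ (conj u /|x|²) ((x/|x|)·∇u) dx = ½ ∫ |u|²/|x|³ dx`. -/
theorem radial_derivative_inverse_square_identity
    (u : E2 → ℂ) (hu : ContDiff ℝ (⊤ : ℕ∞) u) (hcomp : HasCompactSupport u)
    (hsupp : (0 : E2) ∉ tsupport u) :
    (∫ x, ((starRingEnd ℂ) (u x) / ((‖x‖ ^ 2 : ℝ) : ℂ)) *
        ∑ j, ((x j / ‖x‖ : ℝ) : ℂ) * pd u j x).re
      = 1 / 2 * ∫ x, ‖u x‖ ^ 2 / ‖x‖ ^ 3 := by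
  have hn1 : ∀ x : E2, x ≠ 0 → ContinuousAt (fun y : E2 => ‖y‖) x :=
    fun x _ => continuous_norm.continuousAt
  have hud : Differentiable ℝ u := hu.differentiable (by simp)
  have hpd : ∀ j, Continuous (pd u j) := fun j =>
    (hu.continuous_fderiv (by simp)).clm_apply continuous_const
  have hI : Integrable (fun x : E2 => ((starRingEnd ℂ) (u x) / ((‖x‖ ^ 2 : ℝ) : ℂ)) *
        ∑ j, ((x j / ‖x‖ : ℝ) : ℂ) * pd u j x) := by
    refine aux_int u hcomp hsupp _ ?_ ?_
    · intro x hx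
      have hn : ‖x‖ ≠ 0 := norm_ne_zero_iff.2 hx
      have hc := hu.continuous
      refine ContinuousAt.mul (ContinuousAt.div (by fun_prop) (by fun_prop) ?_) ?_
      · exact_mod_cast pow_ne_zero 2 hn
      · simp only [Fin.sum_univ_two]
        have h0 := hpd 0
        have h1 := hpd 1
        have hk : ∀ j : Fin 2, ContinuousAt (fun x : E2 => ((x j / ‖x‖ : ℝ) : ℂ)) x := fun j =>
          Complex.continuous_ofReal.continuousAt.comp
            (ContinuousAt.div (by fun_prop) (by fun_prop) hn)
        exact ((hk 0).mul h0.continuousAt).add ((hk 1).mul h1.continuousAt)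
    · intro x hx
      simp [hx]
  have hJ : Integrable (fun x : E2 => ‖u x‖ ^ 2 / ‖x‖ ^ 3) := by
    refine aux_int u hcomp hsupp _ ?_ ?_
    · intro x hx
      have hn : ‖x‖ ≠ 0 := norm_ne_zero_iff.2 hx
      have hc := hu.continuous
      exact ContinuousAt.div (by fun_prop) (by fun_prop) (pow_ne_zero 3 hn)
    · intro x hx
      simp [hx]
  have hF : ∀ j : Fin 2, Integrable (fun x : E2 => fderiv ℝ
        (fun y : E2 => ‖u y‖ ^ 2 * (y j * (‖y‖ ^ 3)⁻¹)) x (EuclideanSpace.single j 1)) ∧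
      ∫ x : E2, fderiv ℝ (fun y : E2 => ‖u y‖ ^ 2 * (y j * (‖y‖ ^ 3)⁻¹)) x
        (EuclideanSpace.single j 1) = 0 := by
    intro j
    have hz : ∀ x : E2, u x = 0 → ‖u x‖ ^ 2 * (x j * (‖x‖ ^ 3)⁻¹) = 0 := by
      intro x hx
      simp [hx]
    refine aux_div _ ?_ ?_ _
    · rw [contDiff_iff_contDiffAt]
      intro x
      by_cases hx : x = 0
      · subst hx
        exact contDiffAt_const.congr_of_eventuallyEq (aux_ev u hsupp _ hz)
      · have hn : ‖x‖ ≠ 0 := norm_ne_zero_iff.2 hx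
        have h1 : ContDiffAt ℝ 1 u x := (hu.of_le (by exact_mod_cast le_top)).contDiffAt
        have h2 : ContDiffAt ℝ 1 (fun y : E2 => y j) x :=
          (EuclideanSpace.proj (𝕜 := ℝ) j : E2 →L[ℝ] ℝ).contDiff.contDiffAt
        exact (h1.norm_sq ℝ).mul (h2.mul (((contDiffAt_norm ℝ hx).pow 3).inv (pow_ne_zero 3 hn)))
    · refine hcomp.mono ?_
      intro x hx hux
      exact hx (hz x hux)
  have hre := integral_re hI
  simp only [RCLike.re_eq_complex_re] at hre
  rw [← hre]
  have hkey : ∫ x : E2, (2 * (((starRingEnd ℂ) (u x) / ((‖x‖ ^ 2 : ℝ) : ℂ)) *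
        ∑ j, ((x j / ‖x‖ : ℝ) : ℂ) * pd u j x).re - ‖u x‖ ^ 2 / ‖x‖ ^ 3) = 0 := by
    have hs := integral_add (hF 0).1 (hF 1).1
    rw [(hF 0).2, (hF 1).2, add_zero] at hs
    rw [← hs]
    apply integral_congr_ae
    have hae : ∀ᵐ x : E2, x ≠ 0 := by
      simp [ae_iff]
    filter_upwards [hae] with x hx
    rw [aux_pt u hud x hx 0, aux_pt u hud x hx 1]
    have hn : ‖x‖ ≠ 0 := norm_ne_zero_iff.2 hx
    have hsq : ‖x‖ ^ 2 = x 0 ^ 2 + x 1 ^ 2 := by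
      rw [EuclideanSpace.norm_sq_eq]
      simp
    have e1 : (((starRingEnd ℂ) (u x) / ((‖x‖ ^ 2 : ℝ) : ℂ)) *
        ∑ j, ((x j / ‖x‖ : ℝ) : ℂ) * pd u j x)
        = ((x 0 / ‖x‖ ^ 3 : ℝ) : ℂ) * ((starRingEnd ℂ) (u x) * pd u 0 x)
          + ((x 1 / ‖x‖ ^ 3 : ℝ) : ℂ) * ((starRingEnd ℂ) (u x) * pd u 1 x) := by
      have hnc : (‖x‖ : ℂ) ≠ 0 := by exact_mod_cast hn
      rw [Fin.sum_univ_two]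
      push_cast
      field_simp
    have e2 : 1 / ‖x‖ ^ 3 - 3 * x 0 ^ 2 / ‖x‖ ^ 5 + (1 / ‖x‖ ^ 3 - 3 * x 1 ^ 2 / ‖x‖ ^ 5)
        = - (1 / ‖x‖ ^ 3) := by
      have e3 : x 0 ^ 2 = ‖x‖ ^ 2 - x 1 ^ 2 := by linarith
      rw [e3]
      field_simp
      ring
    rw [e1, Complex.add_re, Complex.re_ofReal_mul, Complex.re_ofReal_mul]
    linear_combination (-‖u x‖ ^ 2) * e2
  have hIr := hI.re
  simp only [RCLike.re_eq_complex_re] at hIr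
  rw [integral_sub (hIr.const_mul 2) hJ, integral_const_mul] at hkey
  linarith
end
end

section
/- Let u ∈ C_c^∞(ℝ²; ℂ) be radial. Then for every x ≠ 0 the radial Sobolev inequality holds: |x| · |u(x)|² ≤ (1/π) ‖u‖_{L²(ℝ²)} ‖∇u‖_{L²(ℝ²)}. -/
open MeasureTheory Real Complex

noncomputable section

theorem rs_int (f : E2 → ℂ) (hf : Continuous f) (hc : HasCompactSupport f) :
    Integrable (fun y => ‖f y‖ ^ 2) := by
  have h1 : Continuous (fun y => ‖f y‖ ^ 2) := hf.norm.pow 2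
  have h2 : HasCompactSupport (fun y => ‖f y‖ ^ 2) := by
    have h3 : (fun y => ‖f y‖ ^ 2) = (fun z : ℂ => ‖z‖ ^ 2) ∘ f := rfl
    rw [h3]
    exact hc.comp_left (by simp)
  exact h1.integrable_of_hasCompactSupport h2

theorem rs_plane (f : ℝ → ℝ) :
    ∫ y : E2, f ‖y‖ = 2 * π * ∫ s in Set.Ioi (0:ℝ), s * f s := by
  rw [integral_fun_norm_addHaar volume f]
  have hv : (volume : Measure E2).real (Metric.ball 0 1) = π := by
    simp [Measure.real, EuclideanSpace.volume_ball_fin_two]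
    try exact Real.pi_pos.le
  rw [hv]
  simp [finrank_euclideanSpace]
  ring

theorem rs_grad (u : E2 → ℂ) (y v : E2) (hv : ‖v‖ = 1) :
    ‖fderiv ℝ u y v‖ ^ 2 ≤ ∑ j, ‖pd u j y‖ ^ 2 := by
  have h1 : v = v 0 • EuclideanSpace.single 0 1 + v 1 • EuclideanSpace.single 1 1 := by
    ext i; fin_cases i <;> simp
  have h2 : fderiv ℝ u y v = v 0 • pd u 0 y + v 1 • pd u 1 y := by
    conv_lhs => rw [h1]
    simp [pd]
  have h3 : v 0 ^ 2 + v 1 ^ 2 = 1 := by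
    have := EuclideanSpace.norm_sq_eq v
    simp [hv, Fin.sum_univ_two] at this
    linarith
  have h4 : ‖fderiv ℝ u y v‖ ≤ |v 0| * ‖pd u 0 y‖ + |v 1| * ‖pd u 1 y‖ := by
    rw [h2]
    refine (norm_add_le _ _).trans ?_
    simp
  rw [Fin.sum_univ_two]
  have h5 : |v 0| ^ 2 + |v 1| ^ 2 = 1 := by simpa using h3
  generalize |v 0| = a at *
  generalize |v 1| = b at *
  generalize ‖pd u 0 y‖ = c at *
  generalize ‖pd u 1 y‖ = d at *
  calc _ ≤ (a * c + b * d) ^ 2 := by gcongr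
    _ ≤ (a ^ 2 + b ^ 2) * (c ^ 2 + d ^ 2) := by nlinarith [sq_nonneg (a * d - b * c)]
    _ = _ := by rw [h5, one_mul]

theorem rs_1d (h : ℝ → ℂ) (hh : ContDiff ℝ 1 h) (hc : HasCompactSupport h) (r : ℝ) (hr : 0 < r) :
    r * ‖h r‖ ^ 2 ≤ 2 * (√(∫ s in Set.Ioi (0:ℝ), s * ‖h s‖ ^ 2) *
      √(∫ s in Set.Ioi (0:ℝ), s * ‖deriv h s‖ ^ 2)) := by
  have hd : Continuous (deriv h) := hh.continuous_deriv le_rfl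
  have hdc : HasCompactSupport (deriv h) := hc.deriv
  have hφ : ContDiff ℝ 1 (fun t => ‖h t‖ ^ 2) := hh.norm_sq ℝ
  have hφc : HasCompactSupport (fun t => ‖h t‖ ^ 2) :=
    hc.comp_left (g := fun z : ℂ => ‖z‖ ^ 2) (by simp)
  have hder : ∀ t, ‖deriv (fun t => ‖h t‖ ^ 2) t‖ ≤ 2 * (‖h t‖ * ‖deriv h t‖) := by
    intro t
    have := ((hh.differentiable one_ne_zero t).hasDerivAt.norm_sq).deriv
    rw [this, norm_mul]
    simp only [Real.norm_ofNat]
    gcongr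
    exact norm_inner_le_norm _ _
  have hcs := integral_mul_le_Lp_mul_Lq_of_nonneg (μ := volume.restrict (Set.Ioi (0:ℝ)))
    (p := 2) (q := 2) (by constructor <;> norm_num)
    (f := fun s => √s * ‖h s‖) (g := fun s => √s * ‖deriv h s‖)
    (Filter.Eventually.of_forall fun s => by positivity)
    (Filter.Eventually.of_forall fun s => by positivity)
    (((Real.continuous_sqrt.mul hh.continuous.norm).memLp_of_hasCompactSupport
      (hc.norm.mul_left)).restrict _)
    (((Real.continuous_sqrt.mul hd.norm).memLp_of_hasCompactSupport
      (hdc.norm.mul_left)).restrict _)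
  have e1 : ∀ k : ℝ → ℂ, ∫ s in Set.Ioi (0:ℝ), (√s * ‖k s‖) ^ (2:ℝ)
      = ∫ s in Set.Ioi (0:ℝ), s * ‖k s‖ ^ 2 := by
    intro k
    refine setIntegral_congr_fun measurableSet_Ioi fun s hs => ?_
    simp only [Real.rpow_two, mul_pow, Real.sq_sqrt (le_of_lt hs)]
  have e2 : ∫ s in Set.Ioi (0:ℝ), (√s * ‖h s‖) * (√s * ‖deriv h s‖)
      = ∫ s in Set.Ioi (0:ℝ), s * (‖h s‖ * ‖deriv h s‖) := by
    refine setIntegral_congr_fun measurableSet_Ioi fun s hs => ?_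
    have := Real.mul_self_sqrt (le_of_lt hs)
    calc _ = (√s * √s) * (‖h s‖ * ‖deriv h s‖) := by ring
      _ = _ := by rw [this]
  rw [e1, e1 (deriv h), e2, ← Real.sqrt_eq_rpow, ← Real.sqrt_eq_rpow] at hcs
  refine le_trans ?_ (mul_le_mul_of_nonneg_left hcs zero_le_two)
  have hint : Integrable (fun s => s * (‖h s‖ * ‖deriv h s‖)) :=
    (continuous_id.mul (hh.continuous.norm.mul hd.norm)).integrable_of_hasCompactSupport
      (hc.norm.mul_right.mul_left)
  have hint2 : Integrable (fun s => 2 * (‖h s‖ * ‖deriv h s‖)) :=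
    (continuous_const.mul (hh.continuous.norm.mul hd.norm)).integrable_of_hasCompactSupport
      (hc.norm.mul_right.mul_left)
  have hftc := hφc.integral_Ioi_deriv_eq hφ r
  have hb : ‖h r‖ ^ 2 ≤ ∫ s in Set.Ioi r, 2 * (‖h s‖ * ‖deriv h s‖) := by
    have := norm_integral_le_of_norm_le (μ := volume.restrict (Set.Ioi r)) hint2.integrableOn
      (Filter.Eventually.of_forall hder)
    rw [hftc, norm_neg, Real.norm_of_nonneg (by positivity)] at this
    exact this
  calc r * ‖h r‖ ^ 2 ≤ r * ∫ s in Set.Ioi r, 2 * (‖h s‖ * ‖deriv h s‖) := by gcongr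
    _ = ∫ s in Set.Ioi r, r * (2 * (‖h s‖ * ‖deriv h s‖)) := (integral_const_mul _ _).symm
    _ ≤ ∫ s in Set.Ioi r, 2 * (s * (‖h s‖ * ‖deriv h s‖)) := by
        refine setIntegral_mono_on (hint2.const_mul r).integrableOn (hint.const_mul 2).integrableOn
          measurableSet_Ioi fun s hs => ?_
        have : r ≤ s := le_of_lt hs
        have h0 : 0 ≤ ‖h s‖ * ‖deriv h s‖ := by positivity
        nlinarith [mul_le_mul_of_nonneg_right this h0]
    _ = 2 * ∫ s in Set.Ioi r, s * (‖h s‖ * ‖deriv h s‖) := integral_const_mul _ _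
    _ ≤ _ := by
        refine mul_le_mul_of_nonneg_left ?_ zero_le_two
        refine setIntegral_mono_set hint.integrableOn ?_
          (Set.Ioi_subset_Ioi hr.le).eventuallyLE
        filter_upwards [ae_restrict_mem measurableSet_Ioi] with s hs
        have : (0:ℝ) < s := hs
        simp only [Pi.zero_apply]
        positivity

/-- radial Sobolev inequality in the plane: for radial `u ∈ C_c^∞(ℝ²)` and
`x ≠ 0`, `|x| |u(x)|² ≤ (1/π) ‖u‖_{L²} ‖∇u‖_{L²}`. -/
theorem radial_sobolev_inequality
    (u : E2 → ℂ) (hu : ContDiff ℝ (⊤ : ℕ∞) u) (hcomp : HasCompactSupport u)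
    (hrad : IsRadial u) :
    ∀ x : E2, x ≠ 0 →
      ‖x‖ * ‖u x‖ ^ 2
        ≤ (1 / π) * Real.sqrt (∫ y, ‖u y‖ ^ 2) *
            Real.sqrt (∫ y, ∑ j, ‖pd u j y‖ ^ 2) := by
  intro x hx
  obtain ⟨g, hg⟩ := hrad
  have hxn : 0 < ‖x‖ := norm_pos_iff.mpr hx
  set e : E2 := ‖x‖⁻¹ • x with he
  have hunit : ∀ y : E2, y ≠ 0 → ‖‖y‖⁻¹ • y‖ = 1 := fun y hy => by
    rw [norm_smul, norm_inv, norm_norm, inv_mul_cancel₀ (norm_ne_zero_iff.mpr hy)]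
  have hen : ‖e‖ = 1 := hunit x hx
  have hu1 : ContDiff ℝ 1 u := hu.of_le (by exact_mod_cast le_top)
  set h : ℝ → ℂ := fun t => u (t • e) with hh
  have hray : ∀ v : E2, ‖v‖ = 1 → ∀ t : ℝ, u (t • v) = h t := by
    intro v hv t
    simp only [hh, hg, norm_smul, hv, hen]
  have hh1 : ContDiff ℝ 1 h := hu1.comp (contDiff_id.smul contDiff_const)
  have hhc : HasCompactSupport h := by
    refine hcomp.comp_isClosedEmbedding (g := fun t : ℝ => t • e) ?_
    exact isClosedEmbedding_smul_left (by intro h0; simp [h0] at hen)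
  have hux : ∀ y : E2, u y = h ‖y‖ := by
    intro y
    simp only [hh, hg, norm_smul, hen, norm_norm, mul_one]
  have hdh : ∀ y : E2, y ≠ 0 → deriv h ‖y‖ = fderiv ℝ u y (‖y‖⁻¹ • y) := by
    intro y hy
    have hy' := hunit y hy
    have heq : h = fun t : ℝ => u (t • (‖y‖⁻¹ • y)) := funext fun t => (hray _ hy' t).symm
    have hyy : ‖y‖ • (‖y‖⁻¹ • y) = y := smul_inv_smul₀ (norm_ne_zero_iff.mpr hy) y
    have h1 : HasFDerivAt u (fderiv ℝ u y) (‖y‖ • (‖y‖⁻¹ • y)) := by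
      rw [hyy]; exact (hu1.differentiable one_ne_zero y).hasFDerivAt
    have h2 : HasDerivAt (fun t : ℝ => t • (‖y‖⁻¹ • y)) (‖y‖⁻¹ • y) ‖y‖ := by
      simpa using (hasDerivAt_id ‖y‖).smul_const (‖y‖⁻¹ • y)
    rw [heq]
    exact (h1.comp_hasDerivAt _ h2).deriv
  have hA : ∫ y, ‖u y‖ ^ 2 = 2 * π * ∫ s in Set.Ioi (0:ℝ), s * ‖h s‖ ^ 2 := by
    rw [← rs_plane (fun s => ‖h s‖ ^ 2)]
    simp only [← hux]
  have hpdc : ∀ j, Continuous (pd u j) := fun j =>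
    (hu1.continuous_fderiv one_ne_zero).clm_apply continuous_const
  have hpds : ∀ j, HasCompactSupport (pd u j) := fun j =>
    (hcomp.fderiv (𝕜 := ℝ)).comp_left
      (g := fun L : E2 →L[ℝ] ℂ => L (EuclideanSpace.single j 1)) (by simp)
  have hB : 2 * π * ∫ s in Set.Ioi (0:ℝ), s * ‖deriv h s‖ ^ 2 ≤ ∫ y, ∑ j, ‖pd u j y‖ ^ 2 := by
    rw [← rs_plane (fun s => ‖deriv h s‖ ^ 2)]
    refine integral_mono_of_nonneg (Filter.Eventually.of_forall fun y => by positivity) ?_ ?_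
    · refine integrable_finsetSum _ fun j _ => ?_
      exact rs_int _ (hpdc j) (hpds j)
    · have h0 : ∀ᵐ y : E2, y ≠ 0 := by simp [ae_iff]
      filter_upwards [h0] with y hy
      simp only [hdh y hy]
      exact rs_grad u y _ (hunit y hy)
  have hmain := rs_1d h hh1 hhc ‖x‖ hxn
  rw [← hux] at hmain
  refine hmain.trans ?_
  have hpi := Real.pi_pos
  rw [hA]
  refine le_trans (le_of_eq ?_) (mul_le_mul_of_nonneg_left (Real.sqrt_le_sqrt hB) (by positivity))
  have hp2 : 0 ≤ 2 * π := by positivity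
  rw [Real.sqrt_mul hp2 (∫ s in Set.Ioi (0:ℝ), s * ‖h s‖ ^ 2),
    Real.sqrt_mul hp2 (∫ s in Set.Ioi (0:ℝ), s * ‖deriv h s‖ ^ 2)]
  have h2 := Real.mul_self_sqrt (show 0 ≤ 2 * π by positivity)
  generalize √(∫ s in Set.Ioi (0:ℝ), s * ‖h s‖ ^ 2) = a
  generalize √(∫ s in Set.Ioi (0:ℝ), s * ‖deriv h s‖ ^ 2) = b
  calc 2 * (a * b) = 1 / π * (2 * π) * (a * b) := by field_simp
    _ = 1 / π * (√(2 * π) * √(2 * π)) * (a * b) := by rw [h2]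
    _ = _ := by ring
end
end
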